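/- The quotient of the braid group B_3 = ⟨σ1, σ2 | σ1σ2σ1 = σ2σ1σ2⟩ by the normal closure of the set {σ1^4, σ2^4} has exactly 16 conjugacy classes. -/

import Mathlib

/-- The braid relator for `B₃ = ⟨σ1, σ2 | σ1σ2σ1 = σ2σ1σ2⟩`. -/
def braidRels : Set (FreeGroup (Fin 2)) :=
  {FreeGroup.of 0 * FreeGroup.of 1 * FreeGroup.of 0 *
    (FreeGroup.of 1 * FreeGroup.of 0 * FreeGroup.of 1)⁻¹}

/-- The braid group on three strands, as a presented group. -/
abbrev BraidGroup3 : Type := PresentedGroup braidRels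

/-- The generator σ1 of `B₃`. -/
def sigma1 : BraidGroup3 := PresentedGroup.of 0

/-- The generator σ2 of `B₃`. -/
def sigma2 : BraidGroup3 := PresentedGroup.of 1

section NormalForm

variable {G : Type*}

/-- Index set of the normal forms `z ^ k * x ^ i * y ^ j * s` in `B₃/(σ1⁴, σ2⁴)`, where `z` is the
full twist, `x = σ1²`, `y = σ2²` and `s` is one of the six positive permutation braids. -/
abbrev NormalFormIndex : Type := Fin 4 × Fin 2 × Fin 2 × Fin 6

/-- The full twist `(aba)²`. -/
def fullTwist [Monoid G] (a b : G) : G := a * b * a * (a * b * a)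

/-- The positive permutation braids on three strands, evaluated at `a` and `b`. -/
def permBraid [Monoid G] (a b : G) : Fin 6 → G :=
  ![1, a, b, a * b, b * a, a * b * a]

/-- The pure part `z ^ k * x ^ i * y ^ j` of a normal form. -/
def purePart [Monoid G] (a b : G) (k i j : ℕ) : G :=
  fullTwist a b ^ k * (a ^ 2) ^ i * (b ^ 2) ^ j

/-- The element with a given normal form. -/
def normalForm [Monoid G] (a b : G) (n : NormalFormIndex) : G :=
  purePart a b n.1 n.2.1 n.2.2.1 * permBraid a b n.2.2.2

lemma map_normalForm {H : Type*} [Monoid G] [Monoid H] (f : G →* H) (a b : G)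
    (n : NormalFormIndex) : f (normalForm a b n) = normalForm (f a) (f b) n := by
  obtain ⟨k, i, j, s⟩ := n
  have hs : f (permBraid a b s) = permBraid (f a) (f b) s := by
    fin_cases s <;> simp [permBraid]
  simp [normalForm, purePart, fullTwist, hs]

variable [Group G] {a b : G}

lemma halfTwist_mul_left (h : a * b * a = b * a * b) : a * b * a * a = b * (a * b * a) := by
  calc a * b * a * a = b * a * b * a := by rw [h]
    _ = b * (a * b * a) := by group

lemma halfTwist_mul_right (h : a * b * a = b * a * b) : a * b * a * b = a * (a * b * a) := by
  rw [h]
  exact halfTwist_mul_left h.symm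

lemma fullTwist_swap (h : a * b * a = b * a * b) : fullTwist b a = fullTwist a b := by
  simp only [fullTwist, h]

lemma commute_fullTwist_left (h : a * b * a = b * a * b) : Commute (fullTwist a b) a := by
  unfold Commute SemiconjBy fullTwist
  rw [mul_assoc (a * b * a), halfTwist_mul_left h, ← mul_assoc, halfTwist_mul_right h, mul_assoc]

lemma commute_fullTwist_right (h : a * b * a = b * a * b) : Commute (fullTwist a b) b :=
  fullTwist_swap h ▸ commute_fullTwist_left h.symm

lemma fullTwist_eq (h : a * b * a = b * a * b) :
    fullTwist a b = a ^ 2 * (b * a ^ 2 * b⁻¹) * b ^ 2 := by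
  calc fullTwist a b = a * b * (a * (a * b * a)) := by unfold fullTwist; group
    _ = a * (b * (a * b * a)) * b := by rw [← halfTwist_mul_right h]; group
    _ = a ^ 2 * (b * a ^ 2 * b⁻¹) * b ^ 2 := by
      rw [← halfTwist_mul_left h]; simp [pow_two, mul_assoc]

lemma sq_inv_eq_self (ha : a ^ 4 = 1) : (a ^ 2)⁻¹ = a ^ 2 := by
  rw [inv_eq_iff_mul_eq_one, ← pow_add, ha]

lemma conj_sq_eq (h : a * b * a = b * a * b) (ha : a ^ 4 = 1) (hb : b ^ 4 = 1) :
    b * a ^ 2 * b⁻¹ = fullTwist a b * a ^ 2 * b ^ 2 := by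
  calc b * a ^ 2 * b⁻¹ = (a ^ 2)⁻¹ * fullTwist a b * (b ^ 2)⁻¹ := by rw [fullTwist_eq h]; group
    _ = fullTwist a b * a ^ 2 * b ^ 2 := by
      rw [sq_inv_eq_self ha, sq_inv_eq_self hb, ((commute_fullTwist_left h).pow_right 2).eq]

lemma sq_mul_sq (h : a * b * a = b * a * b) (ha : a ^ 4 = 1) (hb : b ^ 4 = 1) :
    b ^ 2 * a ^ 2 = fullTwist a b ^ 2 * (a ^ 2 * b ^ 2) := by
  have hz : Commute (fullTwist a b) (a ^ 2 * b ^ 2) :=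
    ((commute_fullTwist_left h).pow_right 2).mul_right ((commute_fullTwist_right h).pow_right 2)
  have hw : (fullTwist a b * (a ^ 2 * b ^ 2)) ^ 2 = 1 := by
    rw [← mul_assoc, ← conj_sq_eq h ha hb, conj_pow, ← pow_mul, ha, mul_one, mul_inv_cancel]
  rw [hz.mul_pow, pow_two (a ^ 2 * b ^ 2), ← mul_assoc] at hw
  rw [eq_inv_of_mul_eq_one_left hw, mul_inv_rev, sq_inv_eq_self ha, sq_inv_eq_self hb]

lemma fullTwist_pow_four (h : a * b * a = b * a * b) (ha : a ^ 4 = 1) (hb : b ^ 4 = 1) :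
    fullTwist a b ^ 4 = 1 := by
  have h₁ := sq_mul_sq h ha hb
  rw [sq_mul_sq h.symm hb ha, fullTwist_swap h, ← mul_assoc, ← pow_add] at h₁
  exact mul_eq_right.mp h₁.symm

lemma purePart_mul_fullTwist (h : a * b * a = b * a * b) (k i j : ℕ) :
    purePart a b k i j * fullTwist a b = purePart a b (k + 1) i j := by
  have hx := ((commute_fullTwist_left h).pow_right 2).pow_right i
  have hy := ((commute_fullTwist_right h).pow_right 2).pow_right j
  rw [purePart, mul_assoc, ← hy.eq, ← mul_assoc, mul_assoc (_ ^ k), ← hx.eq, ← mul_assoc,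
    ← pow_succ, purePart]

lemma purePart_mul_sq_right (k i j : ℕ) :
    purePart a b k i j * b ^ 2 = purePart a b k i (j + 1) := by
  simp only [purePart, pow_succ _ j, mul_assoc]

lemma purePart_mul_sq_left (h : a * b * a = b * a * b) (ha : a ^ 4 = 1) (hb : b ^ 4 = 1)
    (k i j : ℕ) : purePart a b k i j * a ^ 2 = purePart a b (k + 2 * j) (i + 1) j := by
  induction j generalizing k with
  | zero => simp [purePart, pow_succ, mul_assoc]
  | succ j ih =>
    calc purePart a b k i (j + 1) * a ^ 2
        = purePart a b k i j * fullTwist a b * fullTwist a b * a ^ 2 * b ^ 2 := by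
          rw [← purePart_mul_sq_right, mul_assoc, sq_mul_sq h ha hb, pow_two (fullTwist a b)]
          simp only [mul_assoc]
      _ = purePart a b (k + 2 * (j + 1)) (i + 1) (j + 1) := by
          rw [purePart_mul_fullTwist h, purePart_mul_fullTwist h, ih, purePart_mul_sq_right]
          congr 1; ring

lemma purePart_eq_mod (h : a * b * a = b * a * b) (ha : a ^ 4 = 1) (hb : b ^ 4 = 1)
    (k i j : ℕ) : purePart a b k i j = purePart a b (k % 4) (i % 2) (j % 2) := by
  have hx : (a ^ 2) ^ 2 = 1 := by rw [← pow_mul, ha]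
  have hy : (b ^ 2) ^ 2 = 1 := by rw [← pow_mul, hb]
  rw [purePart, pow_eq_pow_mod k (fullTwist_pow_four h ha hb), pow_eq_pow_mod i hx,
    pow_eq_pow_mod j hy, purePart]

lemma exists_normalForm_eq_purePart_mul (h : a * b * a = b * a * b) (ha : a ^ 4 = 1)
    (hb : b ^ 4 = 1) (k i j : ℕ) (s : Fin 6) :
    ∃ n, normalForm a b n = purePart a b k i j * permBraid a b s :=
  ⟨(Fin.ofNat 4 k, Fin.ofNat 2 i, Fin.ofNat 2 j, s), by
    rw [purePart_eq_mod h ha hb k i j]; rfl⟩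

lemma exists_normalForm_mul_left (h : a * b * a = b * a * b) (ha : a ^ 4 = 1) (hb : b ^ 4 = 1)
    (n : NormalFormIndex) : ∃ m, normalForm a b m = normalForm a b n * a := by
  obtain ⟨k, i, j, s⟩ := n
  suffices ∃ k' i' j' : ℕ, ∃ t, purePart a b k' i' j' * permBraid a b t =
      purePart a b k i j * permBraid a b s * a by
    obtain ⟨k', i', j', t, ht⟩ := this
    obtain ⟨m, hm⟩ := exists_normalForm_eq_purePart_mul h ha hb k' i' j' t
    exact ⟨m, hm.trans ht⟩
  have hx := purePart_mul_sq_left h ha hb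
  have hz := purePart_mul_fullTwist h
  have hy := purePart_mul_sq_right (a := a) (b := b)
  fin_cases s
  · exact ⟨k, i, j, 1, by simp [permBraid]⟩
  · refine ⟨k + 2 * j, i + 1, j, 0, ?_⟩
    change _ * 1 = _ * a * a
    rw [← hx]
    simp [pow_two, mul_assoc]
  · exact ⟨k, i, j, 4, by simp [permBraid, mul_assoc]⟩
  · exact ⟨k, i, j, 5, by simp [permBraid, mul_assoc]⟩
  · refine ⟨k + 1 + 2 * j, i + 1, j + 1, 2, ?_⟩
    change _ * b = _ * (b * a) * a
    rw [← hy, ← hx, ← hz, mul_assoc _ (fullTwist a b), mul_assoc _ (_ * a ^ 2),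
      ← conj_sq_eq h ha hb]
    simp [pow_two, mul_assoc]
  · refine ⟨k, i, j + 1, 3, ?_⟩
    change _ * (a * b) = _ * (a * b * a) * a
    rw [← hy, mul_assoc _ (a * b * a), halfTwist_mul_left h, h]
    simp [pow_two, mul_assoc]

lemma exists_normalForm_mul_right (h : a * b * a = b * a * b) (ha : a ^ 4 = 1) (hb : b ^ 4 = 1)
    (n : NormalFormIndex) : ∃ m, normalForm a b m = normalForm a b n * b := by
  obtain ⟨k, i, j, s⟩ := n
  suffices ∃ k' i' j' : ℕ, ∃ t, purePart a b k' i' j' * permBraid a b t =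
      purePart a b k i j * permBraid a b s * b by
    obtain ⟨k', i', j', t, ht⟩ := this
    obtain ⟨m, hm⟩ := exists_normalForm_eq_purePart_mul h ha hb k' i' j' t
    exact ⟨m, hm.trans ht⟩
  have hx := purePart_mul_sq_left h ha hb
  have hz := purePart_mul_fullTwist h
  have hy := purePart_mul_sq_right (a := a) (b := b)
  fin_cases s
  · exact ⟨k, i, j, 2, by simp [permBraid]⟩
  · exact ⟨k, i, j, 3, by simp [permBraid, mul_assoc]⟩
  · refine ⟨k, i, j + 1, 0, ?_⟩
    change _ * 1 = _ * b * b
    rw [← hy]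
    simp [pow_two, mul_assoc]
  · refine ⟨k + 1 + 2 * (j + 1), i + 1, j + 1, 1, ?_⟩
    change _ * a = _ * (a * b) * b
    have hc := conj_sq_eq h.symm hb ha
    rw [fullTwist_swap h, mul_assoc (fullTwist a b)] at hc
    rw [← hx, ← hy, ← hz, mul_assoc _ (b ^ 2), mul_assoc _ (fullTwist a b), ← hc]
    simp [pow_two, mul_assoc]
  · refine ⟨k, i, j, 5, ?_⟩
    change _ * (a * b * a) = _ * (b * a) * b
    simp only [h, mul_assoc]
  · refine ⟨k + 2 * j, i + 1, j, 4, ?_⟩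
    change _ * (b * a) = _ * (a * b * a) * b
    rw [← hx, mul_assoc _ (a * b * a), halfTwist_mul_right h]
    simp [pow_two, mul_assoc]

lemma normalForm_surjective (h : a * b * a = b * a * b) (ha : a ^ 4 = 1) (hb : b ^ 4 = 1)
    (hab : Subgroup.closure {a, b} = ⊤) : Function.Surjective (normalForm a b) := by
  have hA := exists_normalForm_mul_left h ha hb
  have hB := exists_normalForm_mul_right h ha hb
  intro q
  have hq : q ∈ Subgroup.closure {a, b} := hab ▸ Subgroup.mem_top q
  induction hq using Subgroup.closure_induction_right with
  | one => exact ⟨0, by simp [normalForm, purePart, permBraid]⟩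
  | mul_right u _ v hv ih =>
    obtain ⟨n, rfl⟩ := ih
    obtain rfl | rfl := hv
    exacts [hA n, hB n]
  | mul_inv_cancel u _ v hv ih =>
    obtain ⟨n, rfl⟩ := ih
    have hv4 : v ^ 4 = 1 := by obtain rfl | rfl := hv <;> assumption
    have hV : ∀ n, ∃ m, normalForm a b m = normalForm a b n * v := by
      obtain rfl | rfl := hv <;> assumption
    obtain ⟨n₁, h₁⟩ := hV n
    obtain ⟨n₂, h₂⟩ := hV n₁
    obtain ⟨n₃, h₃⟩ := hV n₂
    have hinv : v⁻¹ = v * v * v := by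
      rw [inv_eq_iff_mul_eq_one, ← hv4]; simp only [pow_succ, pow_zero, one_mul, mul_assoc]
    exact ⟨n₃, by rw [h₃, h₂, h₁, hinv]; simp only [mul_assoc]⟩

end NormalForm

section BurauRepresentation

/-- The reduced Burau representation at `t = 3` over `𝔽₅`, evaluated on normal forms. -/
def burauNormalForm (n : NormalFormIndex) : Matrix (Fin 2) (Fin 2) (ZMod 5) :=
  normalForm !![2, 1; 0, 1] !![1, 0; 3, 2] n

/-- The trace and the determinant of a two by two matrix. -/
def traceDet (M : Matrix (Fin 2) (Fin 2) (ZMod 5)) : ZMod 5 × ZMod 5 :=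
  (M 0 0 + M 1 1, M 0 0 * M 1 1 - M 0 1 * M 1 0)

lemma traceDet_eq (M : Matrix (Fin 2) (Fin 2) (ZMod 5)) : traceDet M = (M.trace, M.det) := by
  rw [Matrix.trace_fin_two, Matrix.det_fin_two, traceDet]

lemma traceDet_eq_of_isConj {M N : Matrix (Fin 2) (Fin 2) (ZMod 5)} (h : IsConj M N) :
    traceDet M = traceDet N := by
  obtain ⟨u, hu⟩ := h
  have hN : N = u.val * M * u⁻¹.val := by rw [hu.eq, Units.mul_inv_cancel_right]
  rw [hN, traceDet_eq, traceDet_eq, Matrix.trace_units_conj, Matrix.det_units_conj]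

/-- Normal forms of representatives of the conjugacy classes of `B₃/(σ1⁴, σ2⁴)`. -/
def conjRepresentative : Fin 16 → NormalFormIndex :=
  ![(0, 0, 0, 0), (1, 0, 0, 0), (2, 0, 0, 0), (3, 0, 0, 0), (0, 1, 0, 0), (1, 1, 0, 0),
    (0, 0, 0, 1), (1, 0, 0, 1), (2, 0, 0, 1), (3, 0, 0, 1), (0, 0, 0, 3), (1, 0, 0, 3),
    (2, 0, 0, 3), (3, 0, 0, 3), (0, 0, 0, 5), (1, 0, 0, 5)]

lemma eq_zero_of_burauNormalForm_eq_one : ∀ n, burauNormalForm n = 1 → n = 0 := by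
  decide +kernel

lemma traceDet_conjRepresentative_injective :
    ∀ r t, traceDet (burauNormalForm (conjRepresentative r)) =
      traceDet (burauNormalForm (conjRepresentative t)) → r = t := by
  decide +kernel

/-- Comparing traces and determinants first keeps the search for a conjugating element short. -/
lemma exists_burauNormalForm_conj : ∀ n, ∃ r,
    traceDet (burauNormalForm n) = traceDet (burauNormalForm (conjRepresentative r)) ∧
      ∃ g, burauNormalForm g * burauNormalForm n =
        burauNormalForm (conjRepresentative r) * burauNormalForm g := by
  decide +kernel

theorem card_conjClasses_eq_sixteen {G : Type*} [Group G] {a b : G} (h : a * b * a = b * a * b)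
    (ha : a ^ 4 = 1) (hb : b ^ 4 = 1) (hab : Subgroup.closure {a, b} = ⊤)
    (f : G →* Matrix (Fin 2) (Fin 2) (ZMod 5)) (hfa : f a = !![2, 1; 0, 1])
    (hfb : f b = !![1, 0; 3, 2]) : Nat.card (ConjClasses G) = 16 := by
  have hsurj := normalForm_surjective h ha hb hab
  have hf (n : NormalFormIndex) : f (normalForm a b n) = burauNormalForm n := by
    rw [map_normalForm, hfa, hfb, burauNormalForm]
  have hinj : Function.Injective f := by
    rw [injective_iff_map_eq_one]
    intro q hq
    obtain ⟨n, rfl⟩ := hsurj q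
    rw [eq_zero_of_burauNormalForm_eq_one n (hf n ▸ hq)]
    simp [normalForm, purePart, permBraid]
  have hbij : Function.Bijective
      fun r ↦ ConjClasses.mk (normalForm a b (conjRepresentative r)) := by
    constructor
    · intro r t hrt
      have hc := f.map_isConj (ConjClasses.mk_eq_mk_iff_isConj.mp hrt)
      rw [hf, hf] at hc
      exact traceDet_conjRepresentative_injective r t (traceDet_eq_of_isConj hc)
    · intro c
      obtain ⟨q, rfl⟩ := ConjClasses.exists_rep c
      obtain ⟨n, rfl⟩ := hsurj q
      obtain ⟨r, -, g, hg⟩ := exists_burauNormalForm_conj n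
      rw [← hf, ← hf, ← hf, ← map_mul, ← map_mul] at hg
      exact ⟨r, (ConjClasses.mk_eq_mk_iff_isConj.mpr
        (isConj_iff.mpr ⟨_, mul_inv_eq_of_eq_mul (hinj hg)⟩)).symm⟩
  rw [← Nat.card_congr (Equiv.ofBijective _ hbij), Nat.card_fin]

/-- The matrix of `σ1` in the reduced Burau representation at `t = 3` over `𝔽₅`. -/
def burauLeft : (Matrix (Fin 2) (Fin 2) (ZMod 5))ˣ :=
  ⟨!![2, 1; 0, 1], !![3, 2; 0, 1], by decide, by decide⟩

/-- The matrix of `σ2` in the reduced Burau representation at `t = 3` over `𝔽₅`. -/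
def burauRight : (Matrix (Fin 2) (Fin 2) (ZMod 5))ˣ :=
  ⟨!![1, 0; 3, 2], !![1, 0; 1, 3], by decide, by decide⟩

/-- The reduced Burau representation of `B₃` at `t = 3` over `𝔽₅`. -/
def burau : BraidGroup3 →* (Matrix (Fin 2) (Fin 2) (ZMod 5))ˣ :=
  PresentedGroup.toGroup (f := ![burauLeft, burauRight]) (by
    rintro r rfl
    simp only [map_mul, map_inv, FreeGroup.lift_apply_of, mul_inv_eq_one]
    ext1
    decide)

lemma burau_sigma1 : burau sigma1 = burauLeft := PresentedGroup.toGroup.of _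

lemma burau_sigma2 : burau sigma2 = burauRight := PresentedGroup.toGroup.of _

end BurauRepresentation

lemma sigma_braid : sigma1 * sigma2 * sigma1 = sigma2 * sigma1 * sigma2 :=
  mul_inv_eq_one.mp (PresentedGroup.one_of_mem (rels := braidRels) rfl)

lemma closure_sigma : Subgroup.closure {sigma1, sigma2} = ⊤ := by
  rw [← PresentedGroup.closure_range_of braidRels]
  congr 1
  ext q
  simp [Fin.exists_fin_two, sigma1, sigma2, eq_comm]

/-- The quotient `B₃/(σ1⁴, σ2⁴)` has exactly 16 conjugacy classes. -/
theorem B3_mod_fourth_powers_conjClasses_card :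
    Nat.card (ConjClasses
      (BraidGroup3 ⧸ Subgroup.normalClosure ({sigma1 ^ 4, sigma2 ^ 4} : Set BraidGroup3)))
      = 16 := by
  set N := Subgroup.normalClosure ({sigma1 ^ 4, sigma2 ^ 4} : Set BraidGroup3)
  have hburau : N ≤ burau.ker := by
    refine Subgroup.normalClosure_le_normal ?_
    rintro q (rfl | rfl)
    · simp only [SetLike.mem_coe, MonoidHom.mem_ker, map_pow, burau_sigma1]
      ext1
      decide
    · simp only [SetLike.mem_coe, MonoidHom.mem_ker, map_pow, burau_sigma2]
      ext1
      decide
  refine card_conjClasses_eq_sixteen (a := QuotientGroup.mk' N sigma1)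
    (b := QuotientGroup.mk' N sigma2) ?_ ?_ ?_ ?_
    ((Units.coeHom _).comp (QuotientGroup.lift N burau hburau)) ?_ ?_
  · simp only [← map_mul, sigma_braid]
  · exact (QuotientGroup.eq_one_iff _).mpr (Subgroup.subset_normalClosure (by simp))
  · exact (QuotientGroup.eq_one_iff _).mpr (Subgroup.subset_normalClosure (by simp))
  · rw [← Set.image_pair, ← MonoidHom.map_closure, closure_sigma, ← MonoidHom.range_eq_map]
    exact MonoidHom.range_eq_top.mpr (QuotientGroup.mk'_surjective N)
  · simp [burau_sigma1, burauLeft]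
  · simp [burau_sigma2, burauRight]
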